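/- For every n ≥ 0, the set T_n of spanning trees of G_n is the disjoint union of the three classes T_n^1, T_n^2, T_n^3, and these classes all have the same cardinality |T_n|/3. -/

import Mathlib

attribute [local instance] Classical.propDecidable

noncomputable section

/-- Points in the plane. -/
abbrev Pt : Type := ℝ × ℝ

/-- The three corner vertices `u₁ = (0,0)`, `u₂ = (1,0)`, `u₃ = (1/2, √3/2)`. -/
def cornerPt : Fin 3 → Pt
  | 0 => (0, 0)
  | 1 => (1, 0)
  | 2 => (1 / 2, Real.sqrt 3 / 2)

/-- The similitude `ψ_i(x) = (x + u_i)/2`. -/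
def psi (i : Fin 3) (x : Pt) : Pt := ((x.1 + (cornerPt i).1) / 2, (x.2 + (cornerPt i).2) / 2)

/-- Vertex set of the Sierpiński graph `G_n`. -/
def sierpV : ℕ → Finset Pt
  | 0 => {cornerPt 0, cornerPt 1, cornerPt 2}
  | n + 1 => (sierpV n).image (psi 0) ∪ (sierpV n).image (psi 1) ∪ (sierpV n).image (psi 2)

/-- Edge set of the Sierpiński graph `G_n`. -/
def sierpE : ℕ → Finset (Sym2 Pt)
  | 0 => {s(cornerPt 0, cornerPt 1), s(cornerPt 1, cornerPt 2), s(cornerPt 2, cornerPt 0)}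
  | n + 1 =>
      (sierpE n).image (Sym2.map (psi 0)) ∪ (sierpE n).image (Sym2.map (psi 1)) ∪
        (sierpE n).image (Sym2.map (psi 2))

/-- The simple graph spanned by a finite set of edges. -/
def graphOf (F : Finset (Sym2 Pt)) : SimpleGraph Pt := SimpleGraph.fromEdgeSet ↑F

/-- Spanning trees of `G_n`: acyclic edge subsets connecting all vertices of `G_n`. -/
def treeSet (n : ℕ) : Finset (Finset (Sym2 Pt)) :=
  (sierpE n).powerset.filter fun F =>
    (graphOf F).IsAcyclic ∧ ∀ x ∈ sierpV n, ∀ y ∈ sierpV n, (graphOf F).Reachable x y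

/-- `S_n^i` (with `i : Fin 3` zero-based): spanning forests of `G_n` with exactly two
components, one containing corner `i`, the other containing the two remaining corners. -/
def twoForestSet (n : ℕ) (i : Fin 3) : Finset (Finset (Sym2 Pt)) :=
  (sierpE n).powerset.filter fun F =>
    (graphOf F).IsAcyclic ∧
    (∀ j, j ≠ i → ¬ (graphOf F).Reachable (cornerPt i) (cornerPt j)) ∧
    (∀ j k, j ≠ i → k ≠ i → (graphOf F).Reachable (cornerPt j) (cornerPt k)) ∧
    (∀ x ∈ sierpV n, ∃ j, (graphOf F).Reachable (cornerPt j) x)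

/-- `R_n`: spanning forests of `G_n` with exactly three components, each containing
exactly one corner vertex. -/
def threeForestSet (n : ℕ) : Finset (Finset (Sym2 Pt)) :=
  (sierpE n).powerset.filter fun F =>
    (graphOf F).IsAcyclic ∧
    (∀ j k, j ≠ k → ¬ (graphOf F).Reachable (cornerPt j) (cornerPt k)) ∧
    (∀ x ∈ sierpV n, ∃ j, (graphOf F).Reachable (cornerPt j) x)

/-- Edges of the copy `ψ_i(G_n)` inside `G_{n+1}`. -/
def psiCellE (i : Fin 3) (n : ℕ) : Finset (Sym2 Pt) := (sierpE n).image (Sym2.map (psi i))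

/-- The class `T_n^i`: for `n ≥ 1`, spanning trees whose unique path from corner `i`
to any other corner `j` stays in `ψ_i(G_{n-1}) ∪ ψ_j(G_{n-1})`; for `n = 0` the
singleton consisting of the two edges of `G_0` incident with corner `i`. -/
def treeClass : ℕ → Fin 3 → Finset (Finset (Sym2 Pt))
  | 0, i => {(sierpE 0).filter fun e => cornerPt i ∈ e}
  | n + 1, i =>
      (treeSet (n + 1)).filter fun F =>
        ∀ j, j ≠ i → ∀ p : (graphOf F).Walk (cornerPt i) (cornerPt j), p.IsPath →
          ∀ e ∈ p.edges, e ∈ psiCellE i n ∪ psiCellE j n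

/-- `ψ_w = ψ_{w₁} ∘ ⋯ ∘ ψ_{w_k}` for a word `w` of length `k`. -/
def psiWord {k : ℕ} (w : Fin k → Fin 3) : Pt → Pt :=
  (List.ofFn w).foldr (fun i g => psi i ∘ g) id

/-- The restriction `π_w(F) = ψ_w^{-1}(F ∩ ψ_w(G_{m-k}))` of an edge set `F ⊆ E G_m`
to the `k`-part indexed by the word `w`, as a subgraph of `G_{m-k}`. -/
def restrictE {k : ℕ} (w : Fin k → Fin 3) (m : ℕ) (F : Finset (Sym2 Pt)) :
    Finset (Sym2 Pt) :=
  (sierpE (m - k)).filter fun e => Sym2.map (psiWord w) e ∈ F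

/-- Number of connected components of the subgraph with edge set `F`,
on the vertex set of `G_m`. -/
def ncomp (m : ℕ) (F : Finset (Sym2 Pt)) : ℕ :=
  Set.ncard {C : Set Pt | ∃ v ∈ sierpV m, C = {x : Pt | x ∈ sierpV m ∧ (graphOf F).Reachable v x}}

/-- Degree of `v` in the edge set `F`. -/
def degIn (F : Finset (Sym2 Pt)) (v : Pt) : ℕ := (F.filter fun e => v ∈ e).card

/-- The subgraph of `G_0` replacing a forest in `Q_1`, used in the trace construction. -/
def traceCell (g : Finset (Sym2 Pt)) : Finset (Sym2 Pt) :=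
  if g ∈ treeClass 1 0 then (sierpE 0).filter (fun e => cornerPt 0 ∈ e)
  else if g ∈ treeClass 1 1 then (sierpE 0).filter (fun e => cornerPt 1 ∈ e)
  else if g ∈ treeClass 1 2 then (sierpE 0).filter (fun e => cornerPt 2 ∈ e)
  else if g ∈ twoForestSet 1 0 then (sierpE 0).filter (fun e => cornerPt 0 ∉ e)
  else if g ∈ twoForestSet 1 1 then (sierpE 0).filter (fun e => cornerPt 1 ∉ e)
  else if g ∈ twoForestSet 1 2 then (sierpE 0).filter (fun e => cornerPt 2 ∉ e)
  else ∅

/-- The trace `Tr f ⊆ E G_n` of an edge set `f ⊆ E G_{n+1}`. -/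
def trace (n : ℕ) (f : Finset (Sym2 Pt)) : Finset (Sym2 Pt) :=
  Finset.univ.biUnion fun w : Fin n → Fin 3 =>
    (traceCell (restrictE w (n + 1) f)).image (Sym2.map (psiWord w))

/-- `Q_n = T_n ∪ S_n^1 ∪ S_n^2 ∪ S_n^3 ∪ R_n`. -/
def qSet (n : ℕ) : Finset (Finset (Sym2 Pt)) :=
  treeSet n ∪ twoForestSet n 0 ∪ twoForestSet n 1 ∪ twoForestSet n 2 ∪ threeForestSet n

lemma mem_sierpV_succ {n : ℕ} {x : Pt} :
    x ∈ sierpV (n + 1) ↔ ∃ i, ∃ v ∈ sierpV n, psi i v = x := by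
  simp [sierpV, Fin.exists_fin_succ]

lemma mem_sierpE_succ {n : ℕ} {e : Sym2 Pt} :
    e ∈ sierpE (n + 1) ↔ ∃ i, e ∈ psiCellE i n := by
  simp [sierpE, psiCellE, Fin.exists_fin_succ]

lemma mem_psiCellE {i : Fin 3} {n : ℕ} {e : Sym2 Pt} :
    e ∈ psiCellE i n ↔ ∃ d ∈ sierpE n, Sym2.map (psi i) d = e := by
  simp [psiCellE]

lemma mem_sierpV_of_mem_sierpE {n : ℕ} {e : Sym2 Pt} (he : e ∈ sierpE n) {v : Pt} (hv : v ∈ e) :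
    v ∈ sierpV n := by
  induction n generalizing e v with
  | zero =>
    simp only [sierpE, Finset.mem_insert, Finset.mem_singleton] at he
    rcases he with rfl | rfl | rfl <;> simp only [Sym2.mem_iff] at hv <;>
      rcases hv with rfl | rfl <;> simp [sierpV]
  | succ n ih =>
    obtain ⟨i, hi⟩ := mem_sierpE_succ.1 he
    obtain ⟨d, hd, rfl⟩ := mem_psiCellE.1 hi
    obtain ⟨w, hw, rfl⟩ := Sym2.mem_map.1 hv
    exact mem_sierpV_succ.2 ⟨i, w, ih hd hw, rfl⟩

/-- Barycentric coordinates with respect to the three corners. -/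
def bary : Fin 3 → Pt → ℝ
  | 0, v => 1 - v.1 - v.2 / Real.sqrt 3
  | 1, v => v.1 - v.2 / Real.sqrt 3
  | 2, v => 2 * (v.2 / Real.sqrt 3)

lemma bary_cornerPt (k j : Fin 3) : bary k (cornerPt j) = if k = j then 1 else 0 := by
  have h : Real.sqrt 3 ≠ 0 := by positivity
  fin_cases k <;> fin_cases j <;> simp [bary, cornerPt] <;> field_simp <;> norm_num

lemma bary_psi (k i : Fin 3) (v : Pt) :
    bary k (psi i v) = (bary k v + if k = i then 1 else 0) / 2 := by
  rw [← bary_cornerPt]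
  fin_cases k <;> simp only [bary, psi] <;> ring

lemma bary_sum (v : Pt) : bary 0 v + bary 1 v + bary 2 v = 1 := by
  simp only [bary]; ring

lemma bary_ext {v w : Pt} (h : ∀ k, bary k v = bary k w) : v = w := by
  have h1 := h 1
  have h2 := h 2
  have hs : Real.sqrt 3 ≠ 0 := by positivity
  simp only [bary] at h1 h2
  have h3 : v.2 / Real.sqrt 3 = w.2 / Real.sqrt 3 := by linarith
  exact Prod.ext (by linarith) (by field_simp at h3; exact h3)

lemma bary_nonneg {n : ℕ} {v : Pt} (hv : v ∈ sierpV n) (k : Fin 3) : 0 ≤ bary k v := by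
  induction n generalizing v with
  | zero =>
    simp only [sierpV, Finset.mem_insert, Finset.mem_singleton] at hv
    rcases hv with rfl | rfl | rfl <;> rw [bary_cornerPt] <;> split_ifs <;> norm_num
  | succ n ih =>
    obtain ⟨i, w, hw, rfl⟩ := mem_sierpV_succ.1 hv
    rw [bary_psi]
    have := ih hw
    split_ifs <;> linarith

lemma psi_injective (i : Fin 3) : Function.Injective (psi i) := by
  intro v w h
  refine bary_ext fun k => ?_
  have := congrArg (bary k) h
  rw [bary_psi, bary_psi] at this
  linarith

lemma cornerPt_injective : Function.Injective cornerPt := by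
  intro i j h
  have := congrArg (bary i) h
  rw [bary_cornerPt, bary_cornerPt] at this
  by_contra hij
  simp [hij] at this

lemma psi_cornerPt_comm (i j : Fin 3) : psi i (cornerPt j) = psi j (cornerPt i) := by
  simp [psi, add_comm]

lemma psi_cornerPt_self (i : Fin 3) : psi i (cornerPt i) = cornerPt i := by
  simp [psi]

lemma psi_cornerPt_ne (i : Fin 3) {j k : Fin 3} (h : j ≠ k) :
    psi i (cornerPt j) ≠ psi i (cornerPt k) :=
  fun e => h (cornerPt_injective (psi_injective i e))

lemma cornerPt_mem_sierpV (n : ℕ) (i : Fin 3) : cornerPt i ∈ sierpV n := by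
  induction n with
  | zero => fin_cases i <;> simp [sierpV]
  | succ n ih => exact mem_sierpV_succ.2 ⟨i, _, ih, psi_cornerPt_self i⟩

/-- Vertices of the copy `ψ_i(G_n)`. -/
def psiCellV (i : Fin 3) (n : ℕ) : Finset Pt := (sierpV n).image (psi i)

lemma psi_cornerPt_mem_psiCellV (i j : Fin 3) (n : ℕ) : psi i (cornerPt j) ∈ psiCellV i n :=
  Finset.mem_image_of_mem _ (cornerPt_mem_sierpV n j)

lemma mem_psiCellV_of_mem_psiCellE {i : Fin 3} {n : ℕ} {e : Sym2 Pt} (he : e ∈ psiCellE i n)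
    {v : Pt} (hv : v ∈ e) : v ∈ psiCellV i n := by
  obtain ⟨d, hd, rfl⟩ := mem_psiCellE.1 he
  obtain ⟨w, hw, rfl⟩ := Sym2.mem_map.1 hv
  exact Finset.mem_image_of_mem _ (mem_sierpV_of_mem_sierpE hd hw)

/-- Two distinct cells meet only in their common junction vertex. -/
lemma eq_of_mem_psiCellV {i j : Fin 3} (hij : i ≠ j) {n : ℕ} {v : Pt}
    (hi : v ∈ psiCellV i n) (hj : v ∈ psiCellV j n) : v = psi i (cornerPt j) := by
  obtain ⟨a, ha, rfl⟩ := Finset.mem_image.1 hi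
  obtain ⟨b, hb, h⟩ := Finset.mem_image.1 hj
  have key : ∀ k, (bary k b + if k = j then 1 else 0) = bary k a + if k = i then 1 else 0 := by
    intro k
    have := congrArg (bary k) h
    rw [bary_psi, bary_psi] at this
    linarith
  have h0 := key 0
  have h1 := key 1
  have h2 := key 2
  have a0 := bary_nonneg ha 0
  have a1 := bary_nonneg ha 1
  have a2 := bary_nonneg ha 2
  have b0 := bary_nonneg hb 0
  have b1 := bary_nonneg hb 1
  have b2 := bary_nonneg hb 2
  have sa := bary_sum a
  have sb := bary_sum b
  congr 1
  refine bary_ext fun k => ?_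
  rw [bary_cornerPt]
  fin_cases i <;> fin_cases j <;> fin_cases k <;> simp at hij h0 h1 h2 ⊢ <;> linarith

lemma graphOf_adj {F : Finset (Sym2 Pt)} {a b : Pt} :
    (graphOf F).Adj a b ↔ s(a, b) ∈ F ∧ a ≠ b := by
  simp [graphOf]

lemma graphOf_mono {A B : Finset (Sym2 Pt)} (h : A ⊆ B) : graphOf A ≤ graphOf B :=
  SimpleGraph.fromEdgeSet_mono (by exact_mod_cast h)

/-- A set closed under adjacency is closed under reachability. -/
lemma reachable_mem_of_closed {V : Type*} {G : SimpleGraph V} (S : Set V)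
    (hS : ∀ a ∈ S, ∀ b, G.Adj a b → b ∈ S) {x y : V} (hx : x ∈ S) (h : G.Reachable x y) :
    y ∈ S := by
  obtain ⟨p⟩ := h
  induction p with
  | nil => exact hx
  | cons hab p ih => exact ih (hS _ hx _ hab)

lemma exists_isPath_of_reachable_subset {A F : Finset (Sym2 Pt)} (hAF : A ⊆ F) {x y : Pt}
    (h : (graphOf A).Reachable x y) :
    ∃ p : (graphOf F).Walk x y, p.IsPath ∧ ∀ e ∈ p.edges, e ∈ A := by
  obtain ⟨p, hp⟩ := h.exists_isPath
  refine ⟨p.mapLe (graphOf_mono hAF), hp.mapLe _, fun e he => ?_⟩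
  rw [SimpleGraph.Walk.edges_mapLe_eq_edges] at he
  have := p.edges_subset_edgeSet he
  simp only [graphOf, SimpleGraph.edgeSet_fromEdgeSet] at this
  exact this.1

lemma reachable_of_edges_mem {A F : Finset (Sym2 Pt)} {x y : Pt} (p : (graphOf F).Walk x y)
    (h : ∀ e ∈ p.edges, e ∈ A) : (graphOf A).Reachable x y := by
  refine ⟨p.transfer (graphOf A) fun e he => ?_⟩
  have := p.edges_subset_edgeSet he
  simp only [graphOf, SimpleGraph.edgeSet_fromEdgeSet] at this ⊢
  exact ⟨h e he, this.2⟩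

/-- In an acyclic graph, vertices joined inside two parts without common edge coincide. -/
lemma eq_of_reachable_disjoint {A B F : Finset (Sym2 Pt)} (hF : (graphOf F).IsAcyclic)
    (hA : A ⊆ F) (hB : B ⊆ F) (hAB : ∀ a b, s(a, b) ∈ A → s(a, b) ∈ B → a = b) {x y : Pt}
    (h1 : (graphOf A).Reachable x y) (h2 : (graphOf B).Reachable x y) : x = y := by
  obtain ⟨p, hp, hpA⟩ := exists_isPath_of_reachable_subset hA h1
  obtain ⟨q, hq, hqB⟩ := exists_isPath_of_reachable_subset hB h2
  obtain rfl : p = q := congrArg Subtype.val ((hF.subsingleton_path x y).elim ⟨p, hp⟩ ⟨q, hq⟩)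
  cases p with
  | nil => rfl
  | cons h p => exact absurd (hAB _ _ (hpA _ (by simp)) (hqB _ (by simp))) h.ne

/-- The part of an edge set lying in the copy `ψ_i(G_n)`. -/
def cellPart (n : ℕ) (F : Finset (Sym2 Pt)) (i : Fin 3) : Finset (Sym2 Pt) :=
  F.filter fun e => e ∈ psiCellE i n

lemma cellPart_subset (n : ℕ) (F : Finset (Sym2 Pt)) (i : Fin 3) : cellPart n F i ⊆ F :=
  Finset.filter_subset _ _

/-- Corners `a` and `b` of the copy `ψ_i(G_n)` are joined inside that copy. -/
def CellLinked (n : ℕ) (F : Finset (Sym2 Pt)) (i a b : Fin 3) : Prop :=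
  (graphOf (cellPart n F i)).Reachable (psi i (cornerPt a)) (psi i (cornerPt b))

section cells

variable {n : ℕ} {F : Finset (Sym2 Pt)}

lemma mem_psiCellV_of_adj {i : Fin 3} {a b : Pt} (h : (graphOf (cellPart n F i)).Adj a b) :
    a ∈ psiCellV i n :=
  mem_psiCellV_of_mem_psiCellE (Finset.mem_filter.1 (graphOf_adj.1 h).1).2 (by simp)

lemma mem_psiCellV_of_reachable {i : Fin 3} {a b : Pt} (ha : a ∈ psiCellV i n)
    (h : (graphOf (cellPart n F i)).Reachable a b) : b ∈ psiCellV i n :=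
  reachable_mem_of_closed (psiCellV i n : Set Pt) (fun _ _ _ h => mem_psiCellV_of_adj h.symm) ha h

lemma exists_cellPart_adj (hF : F ⊆ sierpE (n + 1)) {a b : Pt} (h : (graphOf F).Adj a b) :
    ∃ i, (graphOf (cellPart n F i)).Adj a b := by
  obtain ⟨h1, h2⟩ := graphOf_adj.1 h
  obtain ⟨i, hi⟩ := mem_sierpE_succ.1 (hF h1)
  exact ⟨i, graphOf_adj.2 ⟨Finset.mem_filter.2 ⟨h1, hi⟩, h2⟩⟩

lemma mem_treeSet_iff {m : ℕ} : F ∈ treeSet m ↔ F ⊆ sierpE m ∧ (graphOf F).IsAcyclic ∧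
    ∀ x ∈ sierpV m, ∀ y ∈ sierpV m, (graphOf F).Reachable x y := by
  simp [treeSet]

lemma mem_treeClass_succ_iff (hF : F ∈ treeSet (n + 1)) {i : Fin 3} :
    F ∈ treeClass (n + 1) i ↔ ∀ j, j ≠ i → CellLinked n F i i j ∧ CellLinked n F j i j := by
  obtain ⟨hsub, hac, hconn⟩ := mem_treeSet_iff.1 hF
  simp only [treeClass, Finset.mem_filter, hF, true_and]
  refine forall_congr' fun j => imp_congr_right fun hj => ⟨fun h => ?_, fun h p hp e he => ?_⟩
  · obtain ⟨p, hp⟩ := (hconn _ (cornerPt_mem_sierpV _ i) _ (cornerPt_mem_sierpV _ j)).exists_isPath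
    have hr : (graphOf (cellPart n F i ∪ cellPart n F j)).Reachable (cornerPt i) (cornerPt j) := by
      refine reachable_of_edges_mem p fun e he => ?_
      have heF : e ∈ F := by
        have := p.edges_subset_edgeSet he
        simp only [graphOf, SimpleGraph.edgeSet_fromEdgeSet] at this
        exact this.1
      have := h p hp e he
      simp only [cellPart, Finset.mem_union, Finset.mem_filter] at this ⊢
      tauto
    have hi : cornerPt i ∈ psiCellV i n := by
      simpa [psi_cornerPt_self] using psi_cornerPt_mem_psiCellV i i n
    have hjj : cornerPt j ∈ psiCellV j n := by
      simpa [psi_cornerPt_self] using psi_cornerPt_mem_psiCellV j j n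
    have hx : psi i (cornerPt j) ∈ psiCellV j n := by
      rw [psi_cornerPt_comm]; exact psi_cornerPt_mem_psiCellV j i n
    have := reachable_mem_of_closed
      {v | (graphOf (cellPart n F i)).Reachable (cornerPt i) v ∨
        (graphOf (cellPart n F i)).Reachable (cornerPt i) (psi i (cornerPt j)) ∧
        (graphOf (cellPart n F j)).Reachable (psi i (cornerPt j)) v} ?_ (Or.inl (.refl _)) hr
    · rcases this with h1 | ⟨h1, h2⟩
      · have := eq_of_mem_psiCellV hj hjj (mem_psiCellV_of_reachable hi h1)
        rw [← psi_cornerPt_self] at this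
        exact absurd this (psi_cornerPt_ne j hj)
      · refine ⟨by rwa [CellLinked, psi_cornerPt_self], ?_⟩
        rwa [CellLinked, psi_cornerPt_self, psi_cornerPt_comm]
    · intro a ha b hab
      have hab' : (graphOf (cellPart n F i)).Adj a b ∨ (graphOf (cellPart n F j)).Adj a b := by
        simp only [graphOf_adj, Finset.mem_union] at hab ⊢
        tauto
      rcases ha with ha | ⟨ha1, ha⟩ <;> rcases hab' with hab' | hab'
      · exact Or.inl (ha.trans hab'.reachable)
      · obtain rfl := eq_of_mem_psiCellV hj.symm (mem_psiCellV_of_reachable hi ha)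
          (mem_psiCellV_of_adj hab')
        exact Or.inr ⟨ha, hab'.reachable⟩
      · obtain rfl := eq_of_mem_psiCellV hj.symm (mem_psiCellV_of_adj hab')
          (mem_psiCellV_of_reachable hx ha)
        exact Or.inl (ha1.trans hab'.reachable)
      · exact Or.inr ⟨ha1, ha.trans hab'.reachable⟩
  · obtain ⟨h1, h2⟩ := h
    rw [CellLinked, psi_cornerPt_self] at h1
    rw [CellLinked, psi_cornerPt_self, psi_cornerPt_comm] at h2
    have hr : (graphOf (cellPart n F i ∪ cellPart n F j)).Reachable (cornerPt i) (cornerPt j) :=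
      (h1.mono (graphOf_mono Finset.subset_union_left)).trans
        (h2.mono (graphOf_mono Finset.subset_union_right))
    obtain ⟨q, hq, hqA⟩ := exists_isPath_of_reachable_subset
      (Finset.union_subset (cellPart_subset n F i) (cellPart_subset n F j)) hr
    obtain rfl : p = q := congrArg Subtype.val ((hac.subsingleton_path _ _).elim ⟨p, hp⟩ ⟨q, hq⟩)
    have := hqA e he
    simp only [cellPart, Finset.mem_union, Finset.mem_filter] at this ⊢
    tauto

lemma CellLinked.symm {i a b : Fin 3} (h : CellLinked n F i a b) : CellLinked n F i b a :=
  SimpleGraph.Reachable.symm h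

lemma CellLinked.trans {i a b c : Fin 3} (hab : CellLinked n F i a b) (hbc : CellLinked n F i b c) :
    CellLinked n F i a c :=
  SimpleGraph.Reachable.trans hab hbc

/-- In a spanning tree, each outer corner is joined to a junction inside its cell. -/
lemma exists_cellLinked_of_mem_treeSet (hF : F ∈ treeSet (n + 1)) {i j k : Fin 3} (hij : i ≠ j)
    (hk : ∀ m, m = i ∨ m = j ∨ m = k) : CellLinked n F i i j ∨ CellLinked n F i i k := by
  obtain ⟨hsub, -, hconn⟩ := mem_treeSet_iff.1 hF
  by_contra! hcon
  have hi : psi i (cornerPt i) ∈ psiCellV i n := psi_cornerPt_mem_psiCellV i i n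
  have hr := hconn _ (cornerPt_mem_sierpV _ i) _ (cornerPt_mem_sierpV _ j)
  rw [← psi_cornerPt_self i, ← psi_cornerPt_self j] at hr
  have := reachable_mem_of_closed
    {v | (graphOf (cellPart n F i)).Reachable (psi i (cornerPt i)) v} ?_ (.refl _) hr
  · have := eq_of_mem_psiCellV hij.symm (psi_cornerPt_mem_psiCellV j j n)
      (mem_psiCellV_of_reachable hi this)
    exact psi_cornerPt_ne j hij.symm this
  · intro a ha b hab
    obtain ⟨m, hm⟩ := exists_cellPart_adj hsub hab
    by_cases hmi : m = i
    · subst hmi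
      exact SimpleGraph.Reachable.trans ha hm.reachable
    · obtain rfl := eq_of_mem_psiCellV (Ne.symm hmi) (mem_psiCellV_of_reachable hi ha)
        (mem_psiCellV_of_adj hm)
      rcases hk m with rfl | rfl | rfl
      · exact absurd rfl hmi
      · exact absurd ha hcon.1
      · exact absurd ha hcon.2

/-- In a spanning tree, at most one cell fails to join its two junctions. -/
lemma cellLinked_or_cellLinked_of_mem_treeSet (hF : F ∈ treeSet (n + 1)) {i j k : Fin 3}
    (hij : i ≠ j) (hik : i ≠ k) (hjk : j ≠ k) (hk : ∀ m, m = i ∨ m = j ∨ m = k) :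
    CellLinked n F i j k ∨ CellLinked n F j i k := by
  obtain ⟨hsub, -, hconn⟩ := mem_treeSet_iff.1 hF
  by_contra! hcon
  obtain ⟨c1, c2⟩ := hcon
  have hxi : psi i (cornerPt j) ∈ psiCellV i n := psi_cornerPt_mem_psiCellV i j n
  have hxj : psi i (cornerPt j) ∈ psiCellV j n := by
    rw [psi_cornerPt_comm]; exact psi_cornerPt_mem_psiCellV j i n
  rw [CellLinked, psi_cornerPt_comm j i] at c2
  rw [CellLinked] at c1
  have hr := hconn (psi i (cornerPt j)) (mem_sierpV_succ.2 ⟨_, _, cornerPt_mem_sierpV n j, rfl⟩)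
    (psi j (cornerPt k)) (mem_sierpV_succ.2 ⟨_, _, cornerPt_mem_sierpV n k, rfl⟩)
  have := reachable_mem_of_closed
    {v | (graphOf (cellPart n F i)).Reachable (psi i (cornerPt j)) v ∨
      (graphOf (cellPart n F j)).Reachable (psi i (cornerPt j)) v} ?_ (Or.inl (.refl _)) hr
  · rcases this with h | h
    · have h3 := eq_of_mem_psiCellV hik (mem_psiCellV_of_reachable hxi h)
        (by rw [psi_cornerPt_comm]; exact psi_cornerPt_mem_psiCellV k j n)
      rw [h3] at h
      exact c1 h
    · exact c2 h
  · intro a ha b hab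
    obtain ⟨m, hm⟩ := exists_cellPart_adj hsub hab
    rcases ha with ha | ha <;> rcases hk m with rfl | rfl | rfl
    · exact Or.inl (ha.trans hm.reachable)
    · obtain rfl := eq_of_mem_psiCellV hij (mem_psiCellV_of_reachable hxi ha)
        (mem_psiCellV_of_adj hm)
      exact Or.inr hm.reachable
    · obtain rfl := eq_of_mem_psiCellV hik (mem_psiCellV_of_reachable hxi ha)
        (mem_psiCellV_of_adj hm)
      exact absurd ha c1
    · obtain rfl := eq_of_mem_psiCellV hij (mem_psiCellV_of_adj hm)
        (mem_psiCellV_of_reachable hxj ha)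
      exact Or.inl hm.reachable
    · exact Or.inr (ha.trans hm.reachable)
    · obtain rfl := eq_of_mem_psiCellV hjk (mem_psiCellV_of_reachable hxj ha)
        (mem_psiCellV_of_adj hm)
      exact absurd ha c2

/-- In a spanning tree, some cell does not join its two junctions. -/
lemma not_cellLinked_cycle (hF : F ∈ treeSet (n + 1)) :
    ¬ (CellLinked n F 0 1 2 ∧ CellLinked n F 1 0 2 ∧ CellLinked n F 2 0 1) := by
  rintro ⟨h0, h1, h2⟩
  obtain ⟨-, hac, -⟩ := mem_treeSet_iff.1 hF
  rw [CellLinked, psi_cornerPt_comm 1 0] at h1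
  rw [CellLinked, psi_cornerPt_comm 2 0, psi_cornerPt_comm 2 1] at h2
  refine psi_cornerPt_ne 0 (by decide : (1 : Fin 3) ≠ 2) (eq_of_reachable_disjoint hac
    (cellPart_subset n F 0) (Finset.union_subset (cellPart_subset n F 1) (cellPart_subset n F 2))
    ?_ h0 ((h1.mono (graphOf_mono Finset.subset_union_left)).trans
        (h2.symm.mono (graphOf_mono Finset.subset_union_right))))
  intro a b hA hB
  have hA' := (Finset.mem_filter.1 hA).2
  have key : ∃ m, (0 : Fin 3) ≠ m ∧ s(a, b) ∈ psiCellE m n := by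
    rcases Finset.mem_union.1 hB with hB | hB
    · exact ⟨1, by decide, (Finset.mem_filter.1 hB).2⟩
    · exact ⟨2, by decide, (Finset.mem_filter.1 hB).2⟩
  obtain ⟨m, hm, hB'⟩ := key
  exact (eq_of_mem_psiCellV hm (mem_psiCellV_of_mem_psiCellE hA' (by simp))
    (mem_psiCellV_of_mem_psiCellE hB' (by simp))).trans
    (eq_of_mem_psiCellV hm (mem_psiCellV_of_mem_psiCellE hA' (by simp))
    (mem_psiCellV_of_mem_psiCellE hB' (by simp))).symm

/-- A spanning tree of `G_{n+1}` lies in exactly one class. -/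
lemma existsUnique_mem_treeClass_succ (hF : F ∈ treeSet (n + 1)) :
    ∃! i, F ∈ treeClass (n + 1) i := by
  have e0 := exists_cellLinked_of_mem_treeSet hF (i := 0) (j := 1) (k := 2) (by decide) (by decide)
  have e1 := exists_cellLinked_of_mem_treeSet hF (i := 1) (j := 0) (k := 2) (by decide) (by decide)
  have e2 := exists_cellLinked_of_mem_treeSet hF (i := 2) (j := 0) (k := 1) (by decide) (by decide)
  have o01 := cellLinked_or_cellLinked_of_mem_treeSet hF (i := 0) (j := 1) (k := 2)
    (by decide) (by decide) (by decide) (by decide)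
  have o02 := cellLinked_or_cellLinked_of_mem_treeSet hF (i := 0) (j := 2) (k := 1)
    (by decide) (by decide) (by decide) (by decide)
  have o12 := cellLinked_or_cellLinked_of_mem_treeSet hF (i := 1) (j := 2) (k := 0)
    (by decide) (by decide) (by decide) (by decide)
  have hc := not_cellLinked_cycle hF
  have sy : ∀ i a b, CellLinked n F i a b ↔ CellLinked n F i b a := fun _ _ _ => ⟨.symm, .symm⟩
  have tr : ∀ i a b c, CellLinked n F i a b → CellLinked n F i b c → CellLinked n F i a c :=
    fun _ _ _ _ => .trans
  have t0 := tr 0 0 1 2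
  have t0' := tr 0 0 2 1
  have t0'' := tr 0 1 0 2
  have t1 := tr 1 1 0 2
  have t1' := tr 1 1 2 0
  have t1'' := tr 1 0 1 2
  have t2 := tr 2 2 0 1
  have t2' := tr 2 2 1 0
  have t2'' := tr 2 0 2 1
  have c0 := mem_treeClass_succ_iff hF (i := 0)
  have c1 := mem_treeClass_succ_iff hF (i := 1)
  have c2 := mem_treeClass_succ_iff hF (i := 2)
  have all : ∀ P : Fin 3 → Prop, (∀ i, P i) ↔ P 0 ∧ P 1 ∧ P 2 := by
    intro P; simp [Fin.forall_fin_succ]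
  have hex : ∀ P : Fin 3 → Prop, (∃ i, P i) ↔ P 0 ∨ P 1 ∨ P 2 := by
    intro P; simp [Fin.exists_fin_succ]
  rw [all] at c0 c1 c2
  simp only [ne_eq, not_true_eq_false, false_imp_iff, true_and, and_true, Fin.reduceEq,
    not_false_eq_true, true_imp_iff, one_ne_zero, zero_ne_one] at c0 c1 c2
  rw [ExistsUnique, hex]
  simp only [all, c0, c1, c2, Fin.reduceEq, imp_false, one_ne_zero, zero_ne_one,
    implies_true, true_and, and_true]
  simp only [sy 0 1 0, sy 0 2 0, sy 0 2 1, sy 1 0 1, sy 1 2 0, sy 1 2 1, sy 2 0 2, sy 2 1 0,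
    sy 2 1 2] at *
  clear tr sy all hex c0 c1 c2
  grind

end cells

/-- The rotation of the plane sending corner `i` to corner `i + 1`. -/
def cornerRot (v : Pt) : Pt :=
  (1 - v.1 / 2 - Real.sqrt 3 / 2 * v.2, Real.sqrt 3 / 2 * v.1 - v.2 / 2)

lemma cornerRot_cornerPt (i : Fin 3) : cornerRot (cornerPt i) = cornerPt (i + 1) := by
  have h : Real.sqrt 3 * Real.sqrt 3 = 3 := Real.mul_self_sqrt (by norm_num)
  fin_cases i <;> ext <;> simp [cornerRot, cornerPt] <;> nlinarith

lemma cornerRot_psi (i : Fin 3) (v : Pt) : cornerRot (psi i v) = psi (i + 1) (cornerRot v) := by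
  simp only [psi, ← cornerRot_cornerPt]
  ext <;> simp [cornerRot] <;> ring

lemma cornerRot_iterate (v : Pt) : cornerRot (cornerRot (cornerRot v)) = v := by
  have h : Real.sqrt 3 * Real.sqrt 3 = 3 := Real.mul_self_sqrt (by norm_num)
  ext <;> simp only [cornerRot]
  · linear_combination (3 / 8 * v.1 - 1 / 4 + Real.sqrt 3 * v.2 / 8) * h
  · linear_combination (3 / 8 * v.2 - Real.sqrt 3 * v.1 / 8) * h

/-- `cornerRot` as a permutation of the plane. -/
def cornerRotEquiv : Pt ≃ Pt where
  toFun := cornerRot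
  invFun v := cornerRot (cornerRot v)
  left_inv := cornerRot_iterate
  right_inv := cornerRot_iterate

/-- The image of an edge set under `cornerRot`. -/
def rotE (F : Finset (Sym2 Pt)) : Finset (Sym2 Pt) := F.image (Sym2.map cornerRot)

lemma rotE_injective : Function.Injective rotE :=
  Finset.image_injective (Sym2.map.injective cornerRotEquiv.injective)

lemma map_cornerRot_mem_psiCellE {i : Fin 3} {n : ℕ}
    (hE : ∀ e ∈ sierpE n, Sym2.map cornerRot e ∈ sierpE n) {e : Sym2 Pt}
    (he : e ∈ psiCellE i n) : Sym2.map cornerRot e ∈ psiCellE (i + 1) n := by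
  obtain ⟨d, hd, rfl⟩ := mem_psiCellE.1 he
  refine mem_psiCellE.2 ⟨_, hE d hd, ?_⟩
  rw [Sym2.map_map, Sym2.map_map]
  congr 1
  funext v
  exact (cornerRot_psi i v).symm

lemma map_cornerRot_mem_sierpE {n : ℕ} {e : Sym2 Pt} (he : e ∈ sierpE n) :
    Sym2.map cornerRot e ∈ sierpE n := by
  induction n generalizing e with
  | zero =>
    simp only [sierpE, Finset.mem_insert, Finset.mem_singleton] at he ⊢
    rcases he with rfl | rfl | rfl <;> simp [cornerRot_cornerPt]
  | succ n ih =>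
    obtain ⟨i, hi⟩ := mem_sierpE_succ.1 he
    exact mem_sierpE_succ.2 ⟨i + 1, map_cornerRot_mem_psiCellE (fun _ => ih) hi⟩

lemma cornerRot_mem_sierpV {n : ℕ} {v : Pt} (hv : v ∈ sierpV n) : cornerRot v ∈ sierpV n := by
  induction n generalizing v with
  | zero =>
    simp only [sierpV, Finset.mem_insert, Finset.mem_singleton] at hv ⊢
    rcases hv with rfl | rfl | rfl <;> simp [cornerRot_cornerPt]
  | succ n ih =>
    obtain ⟨i, w, hw, rfl⟩ := mem_sierpV_succ.1 hv
    exact mem_sierpV_succ.2 ⟨i + 1, _, ih hw, (cornerRot_psi i w).symm⟩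

/-- `cornerRot` is an isomorphism from the graph of `F` to the graph of its image. -/
def rotIso (F : Finset (Sym2 Pt)) : graphOf F ≃g graphOf (rotE F) where
  toEquiv := cornerRotEquiv
  map_rel_iff' := by
    intro a b
    have h : s(cornerRotEquiv a, cornerRotEquiv b) = Sym2.map cornerRot s(a, b) := rfl
    have hinj : Function.Injective (Sym2.map cornerRot) :=
      Sym2.map.injective cornerRotEquiv.injective
    rw [graphOf_adj, graphOf_adj, cornerRotEquiv.injective.ne_iff, h, rotE, hinj.mem_finset_image]

lemma reachable_rotE {F : Finset (Sym2 Pt)} {x y : Pt} (h : (graphOf F).Reachable x y) :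
    (graphOf (rotE F)).Reachable (cornerRot x) (cornerRot y) :=
  h.map (rotIso F).toHom

lemma rotE_mem_treeSet {n : ℕ} {F : Finset (Sym2 Pt)} (hF : F ∈ treeSet n) :
    rotE F ∈ treeSet n := by
  obtain ⟨hsub, hac, hconn⟩ := mem_treeSet_iff.1 hF
  refine mem_treeSet_iff.2 ⟨?_, (rotIso F).isAcyclic_iff.1 hac, fun x hx y hy => ?_⟩
  · exact Finset.image_subset_iff.2 fun e he => map_cornerRot_mem_sierpE (hsub he)
  · rw [← cornerRot_iterate x, ← cornerRot_iterate y]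
    exact reachable_rotE (hconn _ (cornerRot_mem_sierpV (cornerRot_mem_sierpV hx)) _
      (cornerRot_mem_sierpV (cornerRot_mem_sierpV hy)))

lemma CellLinked.rotE {n : ℕ} {F : Finset (Sym2 Pt)} {i a b : Fin 3} (h : CellLinked n F i a b) :
    CellLinked n (rotE F) (i + 1) (a + 1) (b + 1) := by
  have := reachable_rotE h
  rw [cornerRot_psi, cornerRot_psi, cornerRot_cornerPt, cornerRot_cornerPt] at this
  refine this.mono (graphOf_mono (Finset.image_subset_iff.2 fun e he => ?_))
  obtain ⟨h1, h2⟩ := Finset.mem_filter.1 he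
  exact Finset.mem_filter.2 ⟨Finset.mem_image_of_mem _ h1,
    map_cornerRot_mem_psiCellE (fun _ => map_cornerRot_mem_sierpE) h2⟩

lemma rotE_mem_treeClass_succ {n : ℕ} {F : Finset (Sym2 Pt)} {i : Fin 3}
    (hF : F ∈ treeClass (n + 1) i) : rotE F ∈ treeClass (n + 1) (i + 1) := by
  have hT : F ∈ treeSet (n + 1) := (Finset.mem_filter.1 hF).1
  rw [mem_treeClass_succ_iff (rotE_mem_treeSet hT)]
  intro j hj
  have := (mem_treeClass_succ_iff hT).1 hF (j - 1) (by rintro rfl; simp at hj)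
  have h1 := this.1.rotE
  have h2 := this.2.rotE
  rw [sub_add_cancel] at h1 h2
  exact ⟨h1, h2⟩

lemma card_treeClass_le (n : ℕ) (i : Fin 3) :
    (treeClass n i).card ≤ (treeClass n (i + 1)).card := by
  cases n with
  | zero => simp [treeClass]
  | succ n =>
    exact Finset.card_le_card_of_injOn rotE (fun F hF => rotE_mem_treeClass_succ hF)
      rotE_injective.injOn

lemma card_treeClass_eq (n : ℕ) (i j : Fin 3) : (treeClass n i).card = (treeClass n j).card := by
  have h0 := card_treeClass_le n 0
  have h1 := card_treeClass_le n 1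
  have h2 := card_treeClass_le n 2
  simp only [Fin.reduceAdd, zero_add] at h0 h1 h2
  fin_cases i <;> fin_cases j <;> simp <;> omega

lemma mem_sierpE_zero {e : Sym2 Pt} :
    e ∈ sierpE 0 ↔ ∃ i j, i ≠ j ∧ e = s(cornerPt i, cornerPt j) := by
  simp only [sierpE, Finset.mem_insert, Finset.mem_singleton]
  constructor
  · rintro (rfl | rfl | rfl)
    exacts [⟨0, 1, by decide, rfl⟩, ⟨1, 2, by decide, rfl⟩, ⟨2, 0, by decide, rfl⟩]
  · rintro ⟨i, j, hij, rfl⟩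
    fin_cases i <;> fin_cases j <;> simp at hij ⊢

lemma mem_treeClass_zero {F : Finset (Sym2 Pt)} {i : Fin 3} :
    F ∈ treeClass 0 i ↔ F = (sierpE 0).filter fun e => cornerPt i ∈ e := by
  simp [treeClass]

/-- A star is acyclic. -/
lemma isAcyclic_graphOf_of_forall_mem {F : Finset (Sym2 Pt)} {c : Pt} (h : ∀ e ∈ F, c ∈ e) :
    (graphOf F).IsAcyclic := by
  have key : ∀ y, y ≠ c → ¬ ((graphOf F).deleteEdges {s(c, y)}).Reachable c y := by
    intro y hy hr
    refine reachable_mem_of_closed {v | v ≠ y} ?_ (Ne.symm hy) hr rfl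
    rintro a ha b hab rfl
    rw [SimpleGraph.deleteEdges_adj, graphOf_adj] at hab
    obtain ⟨⟨hab, -⟩, hn⟩ := hab
    rcases Sym2.mem_iff.1 (h _ hab) with rfl | rfl
    · exact hn rfl
    · exact hy rfl
  rw [SimpleGraph.isAcyclic_iff_forall_adj_isBridge]
  intro x y hxy
  obtain ⟨h1, h2⟩ := graphOf_adj.1 hxy
  rcases Sym2.mem_iff.1 (h _ h1) with rfl | rfl
  · rw [SimpleGraph.isBridge_iff]
    exact key y h2.symm
  · rw [Sym2.eq_swap, SimpleGraph.isBridge_iff]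
    exact key x h2

lemma treeClass_zero_subset (i : Fin 3) : treeClass 0 i ⊆ treeSet 0 := by
  intro F hF
  obtain rfl := mem_treeClass_zero.1 hF
  refine mem_treeSet_iff.2 ⟨Finset.filter_subset _ _,
    isAcyclic_graphOf_of_forall_mem fun e he => (Finset.mem_filter.1 he).2, ?_⟩
  have key : ∀ x ∈ sierpV 0,
      (graphOf ((sierpE 0).filter fun e => cornerPt i ∈ e)).Reachable (cornerPt i) x := by
    intro x hx
    obtain ⟨j, rfl⟩ : ∃ j, x = cornerPt j := by
      simpa [sierpV, Fin.exists_fin_succ] using hx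
    by_cases hij : i = j
    · rw [hij]
    · exact SimpleGraph.Adj.reachable (graphOf_adj.2 ⟨Finset.mem_filter.2
        ⟨mem_sierpE_zero.2 ⟨i, j, hij, rfl⟩, by simp⟩, cornerPt_injective.ne hij⟩)
  exact fun x hx y hy => (key x hx).symm.trans (key y hy)

/-- A spanning tree has an edge at every corner. -/
lemma exists_mem_corner_of_mem_treeSet {n : ℕ} {F : Finset (Sym2 Pt)} (hF : F ∈ treeSet n)
    (i : Fin 3) : ∃ e ∈ F, cornerPt i ∈ e := by
  obtain ⟨-, -, hconn⟩ := mem_treeSet_iff.1 hF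
  by_contra! h
  obtain ⟨j, hj⟩ := exists_ne i
  refine hj (cornerPt_injective (reachable_mem_of_closed {cornerPt i} ?_ rfl
    (hconn _ (cornerPt_mem_sierpV n i) _ (cornerPt_mem_sierpV n j))))
  rintro a rfl b hab
  exact absurd (by simp) (h _ (graphOf_adj.1 hab).1)

lemma exists_mem_treeClass_zero {F : Finset (Sym2 Pt)} (hF : F ∈ treeSet 0) :
    ∃ i, F ∈ treeClass 0 i := by
  obtain ⟨hsub, hac, -⟩ := mem_treeSet_iff.1 hF
  have cases_E : ∀ e ∈ F, e = s(cornerPt 0, cornerPt 1) ∨ e = s(cornerPt 1, cornerPt 2) ∨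
      e = s(cornerPt 2, cornerPt 0) := fun e he => by simpa [sierpE] using hsub he
  have h0 : s(cornerPt 0, cornerPt 1) ∈ F ∨ s(cornerPt 2, cornerPt 0) ∈ F := by
    obtain ⟨e, he, hm⟩ := exists_mem_corner_of_mem_treeSet hF 0
    rcases cases_E e he with rfl | rfl | rfl <;> simp_all [cornerPt_injective.eq_iff]
  have h1 : s(cornerPt 0, cornerPt 1) ∈ F ∨ s(cornerPt 1, cornerPt 2) ∈ F := by
    obtain ⟨e, he, hm⟩ := exists_mem_corner_of_mem_treeSet hF 1
    rcases cases_E e he with rfl | rfl | rfl <;> simp_all [cornerPt_injective.eq_iff]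
  have h2 : s(cornerPt 1, cornerPt 2) ∈ F ∨ s(cornerPt 2, cornerPt 0) ∈ F := by
    obtain ⟨e, he, hm⟩ := exists_mem_corner_of_mem_treeSet hF 2
    rcases cases_E e he with rfl | rfl | rfl <;> simp_all [cornerPt_injective.eq_iff]
  have hcyc : ¬ (s(cornerPt 0, cornerPt 1) ∈ F ∧ s(cornerPt 1, cornerPt 2) ∈ F ∧
      s(cornerPt 2, cornerPt 0) ∈ F) := by
    rintro ⟨g0, g1, g2⟩
    have hadj : ∀ {A : Finset (Sym2 Pt)} (i j : Fin 3), i ≠ j → s(cornerPt i, cornerPt j) ∈ A →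
        (graphOf A).Reachable (cornerPt i) (cornerPt j) := fun i j hij h =>
      SimpleGraph.Adj.reachable (graphOf_adj.2 ⟨h, cornerPt_injective.ne hij⟩)
    refine cornerPt_injective.ne (by decide : (0 : Fin 3) ≠ 1) (eq_of_reachable_disjoint hac
      (A := {s(cornerPt 0, cornerPt 1)})
      (B := {s(cornerPt 1, cornerPt 2), s(cornerPt 2, cornerPt 0)})
      (by simpa using g0) (by simp [Finset.insert_subset_iff, g1, g2]) ?_
      (hadj 0 1 (by decide) (by simp))
      ((hadj 1 2 (by decide) (by simp)).trans (hadj 2 0 (by decide) (by simp))).symm)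
    intro a b ha hb
    rw [Finset.mem_singleton] at ha
    rw [ha] at hb
    simp [cornerPt_injective.eq_iff] at hb
  have finish : ∀ i : Fin 3, (∀ e ∈ sierpE 0, (e ∈ F ↔ cornerPt i ∈ e)) →
      ∃ i, F ∈ treeClass 0 i := fun i hi => ⟨i, mem_treeClass_zero.2 (by
    ext e
    rw [Finset.mem_filter]
    exact ⟨fun he => ⟨hsub he, (hi e (hsub he)).1 he⟩, fun he => (hi e he.1).2 he.2⟩)⟩
  by_cases g0 : s(cornerPt 0, cornerPt 1) ∈ F
  · by_cases g1 : s(cornerPt 1, cornerPt 2) ∈ F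
    · have g2 : s(cornerPt 2, cornerPt 0) ∉ F := fun g2 => hcyc ⟨g0, g1, g2⟩
      exact finish 1 (by simp [sierpE, g0, g1, g2, cornerPt_injective.eq_iff])
    · have g2 := h2.resolve_left g1
      exact finish 0 (by simp [sierpE, g0, g1, g2, cornerPt_injective.eq_iff])
  · have g1 := h1.resolve_left g0
    have g2 := h0.resolve_left g0
    exact finish 2 (by simp [sierpE, g0, g1, g2, cornerPt_injective.eq_iff])

lemma eq_of_mem_treeClass_zero {F : Finset (Sym2 Pt)} {i j : Fin 3} (hi : F ∈ treeClass 0 i)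
    (hj : F ∈ treeClass 0 j) : i = j := by
  have hk : ∀ i j : Fin 3, ∃ k, i ≠ k ∧ j ≠ k := by decide
  obtain ⟨k, hik, hjk⟩ := hk i j
  have h : s(cornerPt i, cornerPt k) ∈ F := by
    rw [mem_treeClass_zero.1 hi, Finset.mem_filter]
    exact ⟨mem_sierpE_zero.2 ⟨i, k, hik, rfl⟩, by simp⟩
  rw [mem_treeClass_zero.1 hj, Finset.mem_filter, Sym2.mem_iff, cornerPt_injective.eq_iff,
    cornerPt_injective.eq_iff] at h
  exact (h.2.resolve_right hjk).symm

lemma treeClass_subset (n : ℕ) (i : Fin 3) : treeClass n i ⊆ treeSet n := by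
  cases n with
  | zero => exact treeClass_zero_subset i
  | succ n => exact Finset.filter_subset _ _

/-- A spanning tree of `G_n` lies in exactly one class. -/
lemma existsUnique_mem_treeClass {n : ℕ} {F : Finset (Sym2 Pt)} (hF : F ∈ treeSet n) :
    ∃! i, F ∈ treeClass n i := by
  cases n with
  | zero =>
    obtain ⟨i, hi⟩ := exists_mem_treeClass_zero hF
    exact ⟨i, hi, fun j hj => eq_of_mem_treeClass_zero hj hi⟩
  | succ n => exact existsUnique_mem_treeClass_succ hF

/-- `T_n` is the disjoint union of `T_n^1, T_n^2, T_n^3`, all of the same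
cardinality `|T_n|/3`. -/
theorem treeClass_partition (n : ℕ) :
    treeSet n = treeClass n 0 ∪ treeClass n 1 ∪ treeClass n 2 ∧
      (∀ i j : Fin 3, i ≠ j → Disjoint (treeClass n i) (treeClass n j)) ∧
      ∀ i : Fin 3, 3 * (treeClass n i).card = (treeSet n).card := by
  have hunion : treeSet n = treeClass n 0 ∪ treeClass n 1 ∪ treeClass n 2 := by
    refine subset_antisymm (fun F hF => ?_) ?_
    · obtain ⟨i, hi, -⟩ := existsUnique_mem_treeClass hF
      fin_cases i <;> simp_all
    · exact Finset.union_subset (Finset.union_subset (treeClass_subset n 0) (treeClass_subset n 1))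
        (treeClass_subset n 2)
  have hdisj : ∀ i j : Fin 3, i ≠ j → Disjoint (treeClass n i) (treeClass n j) :=
    fun i j hij => Finset.disjoint_left.2 fun F hi hj =>
      hij ((existsUnique_mem_treeClass (treeClass_subset n i hi)).unique hi hj)
  refine ⟨hunion, hdisj, fun i => ?_⟩
  rw [hunion, Finset.card_union_of_disjoint (Finset.disjoint_union_left.2
      ⟨hdisj 0 2 (by decide), hdisj 1 2 (by decide)⟩),
    Finset.card_union_of_disjoint (hdisj 0 1 (by decide)), card_treeClass_eq n 0 i,
    card_treeClass_eq n 1 i, card_treeClass_eq n 2 i]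
  ring

end
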